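/- Let (Ω, F, P) be a probability space, θ > 0, A a nonempty set, and J : A → (Ω → ℝ) an assignment of random variables such that for every a ∈ A, J(a) is integrable and ω ↦ exp(-θ·J(a)(ω)) is integrable. Suppose ā ∈ A satisfies E[J(a)] ≤ E[J(ā)] for all a ∈ A, and B := E[J(ā)] > 0. Let a* ∈ A and set v* := -(1/θ)·log(E[exp(-θ·J(a*))]), and assume v* ≥ 0. Set ρ := v*/B. Then for every a ∈ A, ρ·(-(1/θ)·log(E[exp(-θ·J(a))])) ≤ v*; in particular this holds for any maximizer of the risk-sensitive objective a ↦ -(1/θ)·log(E[exp(-θ·J(a))]). -/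

import Mathlib

open MeasureTheory Real

/-- The risk-sensitive (entropic) value of a random variable is at most its mean. -/
theorem neg_inv_mul_log_integral_exp_le_integral
    {Ω : Type*} [MeasurableSpace Ω] {P : Measure Ω} [IsProbabilityMeasure P]
    {θ : ℝ} (hθ : 0 < θ) {X : Ω → ℝ} (hX : Integrable X P)
    (hexp : Integrable (fun ω => Real.exp (-θ * X ω)) P) :
    -(1 / θ) * Real.log (∫ ω, Real.exp (-θ * X ω) ∂P) ≤ ∫ ω, X ω ∂P := by
  have jensen : Real.exp (∫ ω, -θ * X ω ∂P) ≤ ∫ ω, Real.exp (-θ * X ω) ∂P :=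
    convexOn_exp.map_integral_le Real.continuous_exp.continuousOn isClosed_univ
      (by simp) (hX.const_mul (-θ)) hexp
  have hlog := (Real.le_log_iff_exp_le ((Real.exp_pos _).trans_le jensen)).2 jensen
  rw [integral_const_mul] at hlog
  rw [neg_mul, one_div_mul_eq_div, neg_le, le_div_iff₀ hθ]
  linarith

/-- **Abstract a posteriori suboptimality bound (core of the paper's Proposition).**
For `θ > 0` and a family of payoffs `J : A → Ω → ℝ` (each integrable together with
`exp (-θ J a)`), let `ā` maximize the mean payoff with optimal mean `B = E[J ā] > 0`,
let `a*` be any element with risk-sensitive value `v* = -(1/θ) log E[exp (-θ J a*)] ≥ 0`,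
and set `ρ = v* / B`.  Then `ρ · (-(1/θ) log E[exp (-θ J a)]) ≤ v*` for every `a ∈ A`,
in particular for any maximizer of the risk-sensitive objective. -/
theorem suboptimality_bound
    {Ω : Type*} [MeasurableSpace Ω] (P : Measure Ω) [IsProbabilityMeasure P]
    (θ : ℝ) (hθ : 0 < θ)
    (A : Type*) (hA : Nonempty A) (J : A → Ω → ℝ)
    (hint : ∀ a : A, Integrable (J a) P)
    (hexp : ∀ a : A, Integrable (fun ω => Real.exp (-θ * J a ω)) P)
    (abar : A) (habar : ∀ a : A, (∫ ω, J a ω ∂P) ≤ ∫ ω, J abar ω ∂P)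
    (hB : 0 < ∫ ω, J abar ω ∂P)
    (astar : A)
    (hv : 0 ≤ -(1 / θ) * Real.log (∫ ω, Real.exp (-θ * J astar ω) ∂P)) :
    ∀ a : A,
      ((-(1 / θ) * Real.log (∫ ω, Real.exp (-θ * J astar ω) ∂P)) /
          (∫ ω, J abar ω ∂P)) *
        (-(1 / θ) * Real.log (∫ ω, Real.exp (-θ * J a ω) ∂P)) ≤
      -(1 / θ) * Real.log (∫ ω, Real.exp (-θ * J astar ω) ∂P) := by
  intro a
  rw [div_mul_eq_mul_div, div_le_iff₀ hB]
  exact mul_le_mul_of_nonneg_left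
    ((neg_inv_mul_log_integral_exp_le_integral hθ (hint a) (hexp a)).trans (habar a)) hv
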